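/- arXiv:1606.06144 — 3 statements merged into one kernel-verified Lean document; each statement's English description precedes it below -/
import Mathlib

section
/- The dynamical R-matrix of the elliptic quantum group E_{p,γ}[gl₂-hat] satisfies the dynamical Yang–Baxter equation: for all x₁, x₂, x₃, τ ∈ ℂ such that every theta-function value appearing in a denominator is nonzero, the identity R₁₂(x₁−x₂; τ−γh₃)·R₁₃(x₁−x₃; τ)·R₂₃(x₂−x₃; τ−γh₁) = R₂₃(x₂−x₃; τ)·R₁₃(x₁−x₃; τ−γh₂)·R₁₂(x₁−x₂; τ) holds in End(ℂ²⊗ℂ²⊗ℂ²), where R_{ab} denotes R acting on the a-th and b-th tensor factors. -/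
open scoped BigOperators Matrix

/-- The elliptic theta function `[x]` with nome `p`. -/
noncomputable def theta (p : ℝ) (x : ℂ) : ℂ :=
  (1/2) * ∑' n : ℤ, Complex.exp (Real.pi * Complex.I * ((n : ℂ) - 1/2)) *
    (p : ℂ) ^ (((n : ℂ) + 1/2)^2) * Complex.exp (-(2*(n : ℂ)+1) * x)

/-- Cartan weight of a basis vector of `ℂ²` (eigenvalue of `h = diag(1,-1)`). -/
noncomputable def hw (i : Fin 2) : ℂ := 1 - 2 * (i : ℕ)

/-- The dynamical R-matrix of `E_{p,γ}[gl₂-hat]`. -/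
noncomputable def Rmat (p : ℝ) (γ x τ : ℂ) : Matrix (Fin 2 × Fin 2) (Fin 2 × Fin 2) ℂ :=
  Matrix.of fun a b =>
    if a = (0,0) ∧ b = (0,0) then theta p (x + γ)
    else if a = (0,1) ∧ b = (0,1) then theta p (τ - γ) * theta p x / theta p τ
    else if a = (0,1) ∧ b = (1,0) then theta p (τ - x) * theta p γ / theta p τ
    else if a = (1,0) ∧ b = (0,1) then theta p (τ + x) * theta p γ / theta p τ
    else if a = (1,0) ∧ b = (1,0) then theta p (τ + γ) * theta p x / theta p τ
    else if a = (1,1) ∧ b = (1,1) then theta p (x + γ)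
    else 0

/-- `R₁₂` acting on `ℂ²⊗ℂ²⊗ℂ²`, with dynamical parameter a function `τf` of the
(eigenvalue label of the) third, spectator, factor. -/
noncomputable def R12t (p : ℝ) (γ x : ℂ) (τf : Fin 2 → ℂ) :
    Matrix (Fin 2 × Fin 2 × Fin 2) (Fin 2 × Fin 2 × Fin 2) ℂ :=
  Matrix.of fun a b =>
    if a.2.2 = b.2.2 then Rmat p γ x (τf a.2.2) (a.1, a.2.1) (b.1, b.2.1) else 0

/-- `R₁₃` acting on `ℂ²⊗ℂ²⊗ℂ²`, with dynamical parameter a function of the second factor. -/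
noncomputable def R13t (p : ℝ) (γ x : ℂ) (τf : Fin 2 → ℂ) :
    Matrix (Fin 2 × Fin 2 × Fin 2) (Fin 2 × Fin 2 × Fin 2) ℂ :=
  Matrix.of fun a b =>
    if a.2.1 = b.2.1 then Rmat p γ x (τf a.2.1) (a.1, a.2.2) (b.1, b.2.2) else 0

/-- `R₂₃` acting on `ℂ²⊗ℂ²⊗ℂ²`, with dynamical parameter a function of the first factor. -/
noncomputable def R23t (p : ℝ) (γ x : ℂ) (τf : Fin 2 → ℂ) :
    Matrix (Fin 2 × Fin 2 × Fin 2) (Fin 2 × Fin 2 × Fin 2) ℂ :=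
  Matrix.of fun a b =>
    if a.1 = b.1 then Rmat p γ x (τf a.1) (a.2.1, a.2.2) (b.2.1, b.2.2) else 0

lemma summable_exp_quadratic {L : ℂ} (hL : L.re < 0) (b c : ℂ) :
    Summable fun n : ℤ => Complex.exp (L * (n : ℂ) ^ 2 + b * n + c) := by
  have hpi : (Real.pi : ℂ) ≠ 0 := by exact_mod_cast Real.pi_ne_zero
  have him : 0 < (-(Complex.I * L) / (Real.pi : ℂ)).im := by
    rw [Complex.div_ofReal_im]
    have : 0 < (-(Complex.I * L)).im := by simpa using hL
    positivity
  refine (((summable_jacobiTheta₂_term_iff (b / (2 * Real.pi * Complex.I)) _).2 him).mul_left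
    (Complex.exp c)).congr fun n => ?_
  rw [jacobiTheta₂_term, ← Complex.exp_add]
  congr 1
  have hI := Complex.I_sq
  field_simp
  linear_combination (-(n : ℂ) ^ 2 * L) * hI

/-- The bijection behind the change of summation indices `(m + n + 1, m - n)`, split according to
the parity of `m + n`. -/
noncomputable def sumDiffParityEquiv : (ℤ × ℤ) ⊕ (ℤ × ℤ) ≃ ℤ × ℤ :=
  Equiv.ofBijective
    (Sum.elim (fun q => (q.1 + q.2, q.1 - q.2 - 1)) (fun q => (q.1 + q.2, q.1 - q.2))) <| by
    constructor
    · rintro (⟨a, b⟩ | ⟨a, b⟩) (⟨c, d⟩ | ⟨c, d⟩) h <;>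
        simp only [Sum.elim_inl, Sum.elim_inr, Prod.mk.injEq, Sum.inl.injEq, Sum.inr.injEq,
          reduceCtorEq] at h ⊢ <;> omega
    · rintro ⟨m, n⟩
      rcases Int.even_or_odd' (m + n) with ⟨k, hk | hk⟩
      · refine ⟨Sum.inr (k, m - k), ?_⟩
        simp only [Sum.elim_inr, Prod.mk.injEq]
        omega
      · refine ⟨Sum.inl (k + 1, m - k - 1), ?_⟩
        simp only [Sum.elim_inl, Prod.mk.injEq]
        omega

lemma sumDiffParityEquiv_inl (q : ℤ × ℤ) :
    sumDiffParityEquiv (.inl q) = (q.1 + q.2, q.1 - q.2 - 1) := rfl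

lemma sumDiffParityEquiv_inr (q : ℤ × ℤ) :
    sumDiffParityEquiv (.inr q) = (q.1 + q.2, q.1 - q.2) := rfl

section Theta

variable {p : ℝ}

lemma theta_eq_tsum_exp (hp : 0 < p) (x : ℂ) :
    theta p x = (1 / 2) * ∑' n : ℤ, Complex.exp (Real.pi * Complex.I * ((n : ℂ) - 1 / 2) +
      Real.log p * ((n : ℂ) + 1 / 2) ^ 2 + -(2 * (n : ℂ) + 1) * x) := by
  have hp' : (p : ℂ) ≠ 0 := by exact_mod_cast hp.ne'
  simp only [theta, Complex.cpow_def_of_ne_zero hp', Complex.exp_add, Complex.ofReal_log hp.le]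

lemma theta_neg (hp : 0 < p) (x : ℂ) : theta p (-x) = -theta p x := by
  rw [theta_eq_tsum_exp hp, theta_eq_tsum_exp hp, ← mul_neg, ← tsum_neg,
    ← (Equiv.subLeft (-1 : ℤ)).tsum_eq]
  congr 2 with n
  have h : Complex.exp (Real.pi * Complex.I * (-2 * n - 1)) = -1 := by
    rw [show Real.pi * Complex.I * (-2 * n - 1) =
        ((-n : ℤ) : ℂ) * (2 * Real.pi * Complex.I) - Real.pi * Complex.I by push_cast; ring,
      Complex.exp_sub, Complex.exp_int_mul_two_pi_mul_I, Complex.exp_pi_mul_I]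
    norm_num
  rw [neg_eq_neg_one_mul (Complex.exp _), ← h,
      ← Complex.exp_add]
  congr 1
  simp only [Equiv.subLeft_apply]
  push_cast
  ring

/-- The product `[x + y][x - y]` is a `2 × 2` determinant of theta functions of nome `p ^ 2`. -/
lemma exists_theta_add_mul_theta_sub (hp : 0 < p) (hp1 : p < 1) :
    ∃ A B : ℂ → ℂ, ∀ x y, theta p (x + y) * theta p (x - y) = A x * B y - B x * A y := by
  set L : ℂ := (Real.log p : ℂ) with hLdef
  have hL : L.re < 0 := by
    rw [hLdef, Complex.ofReal_re]
    exact Real.log_neg hp hp1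
  have hL2 : (2 * L).re < 0 := by
    rw [show (2 * L).re = 2 * L.re by simp]
    linarith
  let e : ℂ → ℤ → ℂ := fun x k => Complex.exp (2 * L * (k : ℂ) ^ 2 - 4 * k * x)
  let o : ℂ → ℤ → ℂ := fun x k =>
    Complex.exp (2 * L * ((k : ℂ) + 1 / 2) ^ 2 - (4 * k + 2) * x)
  let t : ℂ → ℤ → ℂ := fun x n => Complex.exp (Real.pi * Complex.I * ((n : ℂ) - 1 / 2) +
      L * ((n : ℂ) + 1 / 2) ^ 2 + -(2 * (n : ℂ) + 1) * x)
  have he (x : ℂ) : Summable fun k => ‖e x k‖ :=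
    ((summable_exp_quadratic hL2 (-4 * x) 0).congr fun k => by
      simp only [e]; congr 1; ring).norm
  have ho (x : ℂ) : Summable fun k => ‖o x k‖ :=
    ((summable_exp_quadratic hL2 (2 * L - 4 * x) (L / 2 - 2 * x)).congr fun k => by
      simp only [o]; congr 1; ring).norm
  have ht (x : ℂ) : Summable fun k => ‖t x k‖ :=
    ((summable_exp_quadratic hL (Real.pi * Complex.I + L - 2 * x)
      (-(Real.pi * Complex.I) / 2 + L / 4 - x)).congr fun k => by
        simp only [t]; congr 1; ring).norm
  refine ⟨fun x => (1 / 2) * ∑' k, e x k, fun x => (1 / 2) * ∑' k, o x k, fun x y => ?_⟩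
  have hl (q : ℤ × ℤ) : t (x + y) (sumDiffParityEquiv (.inl q)).1 *
      t (x - y) (sumDiffParityEquiv (.inl q)).2 = e x q.1 * o y q.2 := by
    simp only [t, e, o, sumDiffParityEquiv_inl]
    rw [← Complex.exp_add, ← Complex.exp_add]
    refine Complex.exp_eq_exp_iff_exists_int.2 ⟨q.1 - 1, ?_⟩
    push_cast
    ring
  have hr (q : ℤ × ℤ) : t (x + y) (sumDiffParityEquiv (.inr q)).1 *
      t (x - y) (sumDiffParityEquiv (.inr q)).2 = -(o x q.1 * e y q.2) := by
    have h : Complex.exp (((q.1 : ℤ) : ℂ) * (2 * Real.pi * Complex.I) - Real.pi * Complex.I)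
        = -1 := by
      rw [Complex.exp_sub, Complex.exp_int_mul_two_pi_mul_I, Complex.exp_pi_mul_I]
      norm_num
    simp only [t, e, o, sumDiffParityEquiv_inr]
    rw [← Complex.exp_add, ← Complex.exp_add, neg_eq_neg_one_mul (Complex.exp _), ← h,
      ← Complex.exp_add]
    congr 1
    push_cast
    ring
  have key : (∑' n, t (x + y) n) * ∑' n, t (x - y) n =
      (∑' k, e x k) * (∑' k, o y k) - (∑' k, o x k) * ∑' k, e y k := by
    rw [tsum_mul_tsum_of_summable_norm (ht _) (ht _),
      tsum_mul_tsum_of_summable_norm (he _) (ho _),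
      tsum_mul_tsum_of_summable_norm (ho _) (he _), ← sumDiffParityEquiv.tsum_eq]
    have h1 := (summable_mul_of_summable_norm (he x) (ho y)).hasSum
    have h2 := (summable_mul_of_summable_norm (ho x) (he y)).hasSum.neg
    rw [sub_eq_add_neg]
    exact (HasSum.sum (f := fun q => t (x + y) (sumDiffParityEquiv q).1 *
      t (x - y) (sumDiffParityEquiv q).2) (h1.congr_fun hl) (h2.congr_fun hr)).tsum_eq
  rw [theta_eq_tsum_exp hp, theta_eq_tsum_exp hp]
  linear_combination (1 / 4) * key

/-- The three-term (Weierstrass) identity for the theta function. -/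
lemma theta_three_term (hp : 0 < p) (hp1 : p < 1) (s b c d : ℂ) :
    theta p s * theta p (s - c - d) * theta p (s - b - d) * theta p (s - b - c) =
      theta p (2 * s - b - c - d) * theta p b * theta p c * theta p d +
        theta p (s - d) * theta p (s - c) * theta p (s - b) * theta p (s - b - c - d) := by
  obtain ⟨A, B, h⟩ := exists_theta_add_mul_theta_sub hp hp1
  set X := s - (c + d) / 2 with hX
  set Y := (c + d) / 2 with hY
  set Z := s - b - (c + d) / 2 with hZ
  set W := (c - d) / 2 with hW
  have pair {x y u v : ℂ} (hu : u = x + y) (hv : v = x - y) :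
      theta p u * theta p v = A x * B y - B x * A y := by rw [hu, hv, h]
  have h₁ : theta p s * theta p (s - c - d) = A X * B Y - B X * A Y :=
    pair (by ring) (by ring)
  have h₂ : theta p (s - b - d) * theta p (s - b - c) = A Z * B W - B Z * A W :=
    pair (by ring) (by ring)
  have h₃ : theta p (2 * s - b - c - d) * theta p b = A X * B Z - B X * A Z :=
    pair (by ring) (by ring)
  have h₄ : theta p c * theta p d = A Y * B W - B Y * A W :=
    pair (by ring) (by ring)
  have h₅ : theta p (s - d) * theta p (s - c) = A X * B W - B X * A W :=
    pair (by ring) (by ring)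
  have h₆ : theta p (s - b) * theta p (s - b - c - d) = A Z * B Y - B Z * A Y :=
    pair (by ring) (by ring)
  rw [mul_assoc, h₁, h₂, mul_assoc (_ * _), h₃, h₄, mul_assoc (_ * _), h₅, h₆]
  ring

lemma theta_three_term_self (hp : 0 < p) (hp1 : p < 1) (t c : ℂ) :
    theta p (2 * t - c) * theta p c ^ 3 =
      theta p (t + c) * theta p (t - c) ^ 3 - theta p t ^ 3 * theta p (t - 2 * c) := by
  have h := theta_three_term hp hp1 (2 * t - c) (t - c) (t - c) (t - c)
  have h' := theta_neg hp (t - 2 * c)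
  ring_nf at h h' ⊢
  rw [h, h']
  ring

end Theta

section Entries

variable (p : ℝ) (γ x y z τ : ℂ)

lemma Rmat_apply (i j k l : Fin 2) :
    Rmat p γ x τ (i, j) (k, l) =
      ![![![![theta p (x + γ), 0], ![0, 0]],
          ![![0, theta p (τ - γ) * theta p x / theta p τ],
            ![theta p (τ - x) * theta p γ / theta p τ, 0]]],
        ![![![0, theta p (τ + x) * theta p γ / theta p τ],
            ![theta p (τ + γ) * theta p x / theta p τ, 0]],
          ![![0, 0], ![0, theta p (x + γ)]]]] i j k l := by
  fin_cases i <;> fin_cases j <;> fin_cases k <;> fin_cases l <;> simp [Rmat]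

lemma R12t_mul_R13t_mul_R23t_apply (f g h : Fin 2 → ℂ) (i j k i' j' k' : Fin 2) :
    (R12t p γ x f * R13t p γ y g * R23t p γ z h) (i, j, k) (i', j', k') =
      ∑ a, ∑ b, ∑ c, Rmat p γ x (f k) (i, j) (a, b) * Rmat p γ y (g b) (a, k) (i', c) *
        Rmat p γ z (h i') (b, c) (j', k') := by
  simp only [Matrix.mul_apply, Fintype.sum_prod_type, R12t, R13t, R23t, Matrix.of_apply]
  fin_cases k <;> fin_cases i' <;> simp [Fin.sum_univ_two] <;> ring

lemma R23t_mul_R13t_mul_R12t_apply (f g h : Fin 2 → ℂ) (i j k i' j' k' : Fin 2) :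
    (R23t p γ x f * R13t p γ y g * R12t p γ z h) (i, j, k) (i', j', k') =
      ∑ a, ∑ b, ∑ c, Rmat p γ x (f i) (j, k) (b, c) * Rmat p γ y (g b) (i, c) (a, k') *
        Rmat p γ z (h k') (a, b) (i', j') := by
  simp only [Matrix.mul_apply, Fintype.sum_prod_type, R12t, R13t, R23t, Matrix.of_apply]
  fin_cases i <;> fin_cases k' <;> simp [Fin.sum_univ_two] <;> ring

end Entries

set_option maxHeartbeats 2000000 in
/-- The dynamical R-matrix of `E_{p,γ}[gl₂-hat]` satisfies the dynamical
Yang–Baxter equation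
`R₁₂(x₁−x₂; τ−γh₃) R₁₃(x₁−x₃; τ) R₂₃(x₂−x₃; τ−γh₁)
  = R₂₃(x₂−x₃; τ) R₁₃(x₁−x₃; τ−γh₂) R₁₂(x₁−x₂; τ)`
whenever every theta-function value appearing in a denominator (namely `[τ]`, `[τ−γ]`,
`[τ+γ]`) is nonzero. -/
theorem dynamical_yang_baxter (p : ℝ) (hp : 0 < p) (hp1 : p < 1) (γ x₁ x₂ x₃ τ : ℂ)
    (h0 : theta p τ ≠ 0) (hm : theta p (τ - γ) ≠ 0) (hpl : theta p (τ + γ) ≠ 0) :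
    R12t p γ (x₁ - x₂) (fun k => τ - γ * hw k) *
        R13t p γ (x₁ - x₃) (fun _ => τ) *
        R23t p γ (x₂ - x₃) (fun i => τ - γ * hw i) =
      R23t p γ (x₂ - x₃) (fun _ => τ) *
        R13t p γ (x₁ - x₃) (fun j => τ - γ * hw j) *
        R12t p γ (x₁ - x₂) (fun _ => τ) := by
  obtain ⟨u, hu⟩ : ∃ u, u = x₁ - x₂ := ⟨_, rfl⟩
  obtain ⟨v, hv⟩ : ∃ v, v = x₂ - x₃ := ⟨_, rfl⟩
  have huv : x₁ - x₃ = u + v := by rw [hu, hv]; ring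
  rw [huv, ← hu, ← hv]
  have T := theta_three_term hp hp1
  have T' (t : ℂ) := theta_three_term_self hp hp1 t γ
  have hw0 : τ - γ * hw 0 = τ - γ := by simp [hw]
  have hw1 : τ - γ * hw 1 = τ + γ := by norm_num [hw]
  ext ⟨i, j, k⟩ ⟨i', j', k'⟩
  rw [R12t_mul_R13t_mul_R23t_apply, R23t_mul_R13t_mul_R12t_apply]
  simp only [Fin.sum_univ_two, Rmat_apply]
  fin_cases i <;> fin_cases j <;> fin_cases k <;> fin_cases i' <;> fin_cases j' <;> fin_cases k' <;>
    simp [hw0, hw1]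
  · ring
  · ring
  · linear_combination (norm := (field_simp; ring_nf))
      (theta p γ / (theta p τ * theta p τ)) *
      T τ (-u - v + τ - γ) γ v
  · linear_combination (norm := (field_simp; ring_nf))
      (theta p γ / (theta p τ * theta p τ)) *
      T τ (-u - v + τ - γ) v u
  · linear_combination (norm := (field_simp; ring_nf))
      -(theta p γ * theta p (τ - 2 * γ) / (theta p (τ - γ) * theta p (τ - γ) * theta p τ)) *
      T (v + τ) γ v (-u + τ - γ)
  · linear_combination (norm := (field_simp; ring_nf))
      (theta p u * theta p v * theta p (u + v + γ) / (theta p τ ^ 2 * theta p (τ - γ) ^ 2)) * T' τ +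
      theta p γ ^ 3 / (theta p τ ^ 2 * theta p (τ - γ) ^ 2) * T (u + v + τ) v u (u + v + γ)
  · linear_combination (norm := (field_simp; ring_nf))
      (theta p γ * theta p (τ + γ) / (theta p (τ - γ) * theta p τ * theta p τ)) *
      T τ (-u - v + τ - γ) γ u
  · ring
  · linear_combination (norm := (field_simp; ring_nf))
      -(theta p γ / (theta p (τ + γ) * theta p (τ + γ))) *
      T (τ + γ) (-u - v + τ) γ u
  · linear_combination (norm := (field_simp; ring_nf))
      -(theta p γ / (theta p (τ + γ) * theta p (τ + γ))) *
      T (τ + γ) (-u - v + τ) v u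
  · linear_combination (norm := (field_simp; ring_nf))
      -(theta p γ / (theta p (τ - γ) * theta p (τ - γ))) *
      T (u + v + τ - γ) v u (τ - 2 * γ)
  · linear_combination (norm := (field_simp; ring_nf))
      -(theta p γ / (theta p (τ - γ) * theta p (τ - γ))) *
      T (u + τ) γ u (-v + τ - γ)
  · ring
  · linear_combination (norm := (field_simp; ring_nf))
      (theta p γ * theta p (τ - γ) / (theta p τ * theta p τ * theta p (τ + γ))) *
      T (u + τ + γ) γ u (-v + τ)
  · linear_combination (norm := (field_simp; ring_nf))
      -(theta p u * theta p v * theta p (u + v + γ) / (theta p τ ^ 2 * theta p (τ + γ) ^ 2)) *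
        T' (τ + γ) -
      theta p γ ^ 3 / (theta p τ ^ 2 * theta p (τ + γ) ^ 2) * T (u + v + τ + γ) v u (u + v + γ)
  · linear_combination (norm := (field_simp; ring_nf))
      -(theta p γ * theta p (τ + 2 * γ) / (theta p τ * theta p (τ + γ) * theta p (τ + γ))) *
      T (τ + γ) (-u - v + τ) γ v
  · linear_combination (norm := (field_simp; ring_nf))
      (theta p γ / (theta p τ * theta p τ)) *
      T (u + v + τ) v u (τ - γ)
  · linear_combination (norm := (field_simp; ring_nf))
      (theta p γ / (theta p τ * theta p τ)) *
      T (v + τ + γ) γ v (-u + τ)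
  · ring
  · ring
end

section
/- Vanishing of the reduced type-A coefficient determinant: with σ_i^{(l)} (0 ≤ i, l ≤ L) defined by σ_0^{(l)} := (c(x₀−x_l)/b(x₀−x_l))·∏_{k=1}^L a(x₀−μ_k)·∏_{k=1, k≠l}^L (a(x_k−x₀)/b(x_k−x₀)) for l ≠ 0; σ_l^{(l)} := ∏_{k=1}^L b(x_l−μ_k) − ∏_{k=1}^L a(x_l−μ_k)·∏_{k=0, k≠l}^L (a(x_k−x_l)/b(x_k−x_l)); and otherwise σ_i^{(l)} := (c(x_i−x_l)/b(x_i−x_l))·∏_{k=1}^L a(x_i−μ_k)·∏_{k=0, k≠i,l}^L (a(x_k−x_i)/b(x_k−x_i)), one has det((σ_i^{(l)})_{0≤i,l≤L}) = 0. -/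
open scoped BigOperators Matrix

/-- The six-vertex weight `a(x) = sinh(x+γ)`. -/
noncomputable def av (γ x : ℂ) : ℂ := Complex.sinh (x + γ)

/-- The six-vertex weight `b(x) = sinh(x)`. -/
noncomputable def bv (x : ℂ) : ℂ := Complex.sinh x

/-- The six-vertex weight `c(x) = sinh(γ)`. -/
noncomputable def cv (γ : ℂ) : ℂ := Complex.sinh γ

/-- The vector `(x₀, x₁, …, x_L)` of all `L+1` variables. -/
noncomputable def consv {L : ℕ} (x₀ : ℂ) (x : Fin L → ℂ) : Fin (L + 1) → ℂ :=
  Fin.cons x₀ x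

/-- The coefficients `σ_i^{(l)}` (`0 ≤ i, l ≤ L`) of the reduced type-A system, as
functions of the full variable vector `y = (x₀, x₁, …, x_L)`. -/
noncomputable def sigma6 (γ : ℂ) {L : ℕ} (μ : Fin L → ℂ) (y : Fin (L + 1) → ℂ)
    (l i : Fin (L + 1)) : ℂ :=
  if i = l then
    (∏ k, bv (y l - μ k)) -
      (∏ k, av γ (y l - μ k)) *
        ∏ k ∈ Finset.univ.erase l, av γ (y k - y l) / bv (y k - y l)
  else if i = 0 then
    cv γ / bv (y 0 - y l) * (∏ k, av γ (y 0 - μ k)) *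
      ∏ k ∈ Finset.univ.filter (fun k : Fin L => (k.succ : Fin (L + 1)) ≠ l),
        av γ (y k.succ - y 0) / bv (y k.succ - y 0)
  else
    cv γ / bv (y i - y l) * (∏ k, av γ (y i - μ k)) *
      ∏ k ∈ (Finset.univ.erase i).erase l, av γ (y k - y i) / bv (y k - y i)

theorem sinh_sub_eq_exp (z w : ℂ) :
    Complex.sinh (z - w) =
      (Complex.exp (2 * z) - Complex.exp (2 * w)) * (Complex.exp (-z) * (Complex.exp (-w) / 2)) := by
  have hz : Complex.exp (2 * z) * Complex.exp (-z) = Complex.exp z := by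
    rw [← Complex.exp_add]; ring_nf
  have hw : Complex.exp (2 * w) * Complex.exp (-w) = Complex.exp w := by
    rw [← Complex.exp_add]; ring_nf
  rw [Complex.sinh, neg_sub, sub_eq_add_neg z w, sub_eq_add_neg w z, Complex.exp_add,
    Complex.exp_add]
  linear_combination -(Complex.exp (-w) / 2) * hz + (Complex.exp (-z) / 2) * hw

theorem sinh_sub_div_sinh_sub (z u w : ℂ) :
    Complex.sinh (z - w) / Complex.sinh (u - w) =
      (Complex.exp (2 * u) - Complex.exp (2 * w))⁻¹ *
        (Complex.exp (2 * z) - Complex.exp (2 * w)) * (Complex.exp (-z) / Complex.exp (-u)) := by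
  rw [sinh_sub_eq_exp, sinh_sub_eq_exp]
  have h₁ := Complex.exp_ne_zero (-u)
  have h₂ := Complex.exp_ne_zero (-w)
  by_cases h : Complex.exp (2 * u) - Complex.exp (2 * w) = 0
  · simp [h]
  · field_simp

/-- Lagrange interpolation for products of hyperbolic sines. -/
theorem prod_sinh_sub_eq_sum_lagrange {L : ℕ} (ν : Fin L → ℂ) (y : Fin (L + 1) → ℂ)
    (hy : ∀ k l, k ≠ l → Complex.sinh (y k - y l) ≠ 0) (z : ℂ) :
    ∏ k, Complex.sinh (z - ν k) =
      ∑ l, (∏ k, Complex.sinh (y l - ν k)) *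
        ∏ k ∈ Finset.univ.erase l, Complex.sinh (z - y k) / Complex.sinh (y l - y k) := by
  set p : Polynomial ℂ := ∏ k, (Polynomial.X - Polynomial.C (Complex.exp (2 * ν k))) with hp
  have hprod (w : ℂ) : ∏ k, Complex.sinh (w - ν k) =
      p.eval (Complex.exp (2 * w)) *
        (Complex.exp (-w) ^ L * ∏ k, (Complex.exp (-ν k) / 2)) := by
    simp [hp, sinh_sub_eq_exp, Finset.prod_mul_distrib, Polynomial.eval_prod]
  have hinj : Set.InjOn (fun l => Complex.exp (2 * y l))
      (Finset.univ : Finset (Fin (L + 1))) := by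
    intro k _ l _ hkl
    by_contra hne
    apply hy k l hne
    rw [sinh_sub_eq_exp, sub_eq_zero.mpr hkl, zero_mul]
  have hdeg : p.degree < (Finset.univ : Finset (Fin (L + 1))).card := by
    rw [hp, Polynomial.degree_prod]
    simp only [Polynomial.degree_X_sub_C, Finset.sum_const, Finset.card_univ, Fintype.card_fin,
      nsmul_eq_mul, mul_one]
    exact_mod_cast Nat.lt_succ_self L
  have hinterp := congrArg (Polynomial.eval (Complex.exp (2 * z)))
    (Lagrange.eq_interpolate hinj hdeg)
  rw [Lagrange.interpolate_apply, Polynomial.eval_finsetSum] at hinterp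
  rw [hprod z, hinterp, Finset.sum_mul]
  refine Finset.sum_congr rfl fun l _ => ?_
  rw [hprod (y l)]
  simp_rw [sinh_sub_div_sinh_sub z (y l)]
  rw [Finset.prod_mul_distrib, Finset.prod_const, Finset.card_erase_of_mem (Finset.mem_univ l)]
  simp only [Polynomial.eval_mul, Polynomial.eval_C, Lagrange.basis, Polynomial.eval_prod,
    Lagrange.basisDivisor, Polynomial.eval_sub, Polynomial.eval_X, Finset.card_univ,
    Fintype.card_fin, Nat.add_sub_cancel, div_pow]
  have h := pow_ne_zero L (Complex.exp_ne_zero (-y l))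
  field_simp

theorem sigma6_self (γ : ℂ) {L : ℕ} (μ : Fin L → ℂ) (y : Fin (L + 1) → ℂ) (i : Fin (L + 1)) :
    sigma6 γ μ y i i = (∏ k, bv (y i - μ k)) -
      (∏ k, av γ (y i - μ k)) *
        ∏ k ∈ Finset.univ.erase i, av γ (y k - y i) / bv (y k - y i) :=
  if_pos rfl

theorem sigma6_of_ne (γ : ℂ) {L : ℕ} (μ : Fin L → ℂ) (y : Fin (L + 1) → ℂ)
    {i l : Fin (L + 1)} (hil : i ≠ l) :
    sigma6 γ μ y l i = cv γ / bv (y i - y l) * (∏ k, av γ (y i - μ k)) *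
      ∏ k ∈ (Finset.univ.erase i).erase l, av γ (y k - y i) / bv (y k - y i) := by
  rw [sigma6, if_neg hil]
  split_ifs with hi
  · subst hi
    have himage : ((Finset.univ : Finset (Fin (L + 1))).erase 0).erase l =
        (Finset.univ.filter fun k : Fin L => k.succ ≠ l).image Fin.succ := by
      ext k
      cases k using Fin.cases <;> simp [Fin.succ_ne_zero, hil]
    rw [himage, Finset.prod_image fun _ _ _ _ h => Fin.succ_injective _ h]
  · rfl

theorem av_sub_div_bv_sub (γ u w : ℂ) :
    av γ (w - u) / bv (w - u) = Complex.sinh (u - γ - w) / Complex.sinh (u - w) := by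
  rw [av, bv, ← neg_div_neg_eq, ← Complex.sinh_neg, ← Complex.sinh_neg]
  ring_nf

/-- A vector annihilated by the coefficient matrix of the reduced type-A system. -/
noncomputable def sigma6NullVector (γ : ℂ) {L : ℕ} (μ : Fin L → ℂ) (y : Fin (L + 1) → ℂ)
    (l : Fin (L + 1)) : ℂ :=
  (∏ k, av γ (y l - μ k)) / ∏ k ∈ Finset.univ.erase l, Complex.sinh (y l - y k)

theorem sigma6_mul_nullVector_of_ne (γ : ℂ) {L : ℕ} (μ : Fin L → ℂ) (y : Fin (L + 1) → ℂ)
    (hy : ∀ k l, k ≠ l → Complex.sinh (y k - y l) ≠ 0) {i l : Fin (L + 1)} (hil : i ≠ l) :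
    sigma6 γ μ y l i * sigma6NullVector γ μ y l =
      -sigma6NullVector γ μ y i * ((∏ k, av γ (y l - μ k)) *
        ∏ k ∈ Finset.univ.erase l,
          Complex.sinh (y i - γ - y k) / Complex.sinh (y l - y k)) := by
  have hl : l ∈ Finset.univ.erase i := Finset.mem_erase.mpr ⟨hil.symm, Finset.mem_univ l⟩
  have hi : i ∈ Finset.univ.erase l := Finset.mem_erase.mpr ⟨hil, Finset.mem_univ i⟩
  rw [sigma6_of_ne γ μ y hil, sigma6NullVector, sigma6NullVector]
  simp_rw [av_sub_div_bv_sub]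
  rw [← Finset.mul_prod_erase (Finset.univ.erase i) _ hl, Finset.prod_div_distrib,
    Finset.prod_div_distrib,
    ← Finset.mul_prod_erase (Finset.univ.erase l) (fun k => Complex.sinh (y i - γ - y k)) hi,
    Finset.erase_right_comm (a := l) (b := i)]
  have hsinh : Complex.sinh (y i - γ - y i) = -cv γ := by
    rw [cv, ← Complex.sinh_neg]; ring_nf
  rw [hsinh, bv]
  have h₁ := hy i l hil
  have h₂ : ∏ k ∈ (Finset.univ.erase i).erase l, Complex.sinh (y i - y k) ≠ 0 :=
    Finset.prod_ne_zero_iff.mpr fun k hk =>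
      hy i k (Finset.ne_of_mem_erase (Finset.mem_of_mem_erase hk)).symm
  have h₃ : ∏ k ∈ Finset.univ.erase l, Complex.sinh (y l - y k) ≠ 0 :=
    Finset.prod_ne_zero_iff.mpr fun k hk => hy l k (Finset.ne_of_mem_erase hk).symm
  field_simp

theorem sum_sigma6_mul_nullVector (γ : ℂ) {L : ℕ} (μ : Fin L → ℂ) (y : Fin (L + 1) → ℂ)
    (hy : ∀ k l, k ≠ l → Complex.sinh (y k - y l) ≠ 0) (i : Fin (L + 1)) :
    ∑ l, sigma6 γ μ y l i * sigma6NullVector γ μ y l = 0 := by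
  have hlagrange : ∏ k, bv (y i - μ k) = ∑ l, (∏ k, av γ (y l - μ k)) *
      ∏ k ∈ Finset.univ.erase l,
        Complex.sinh (y i - γ - y k) / Complex.sinh (y l - y k) := by
    convert prod_sinh_sub_eq_sum_lagrange (fun k => μ k - γ) y hy (y i - γ) using 4 with k _ l
    · rw [bv]; ring_nf
    · rw [av]; ring_nf
  rw [← Finset.add_sum_erase _ _ (Finset.mem_univ i),
    Finset.sum_congr rfl fun l hl =>
      sigma6_mul_nullVector_of_ne γ μ y hy (Finset.ne_of_mem_erase hl).symm,
    ← Finset.mul_sum, sigma6_self, hlagrange, ← Finset.add_sum_erase _ _ (Finset.mem_univ i)]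
  simp_rw [av_sub_div_bv_sub]
  ring

theorem sigma6NullVector_ne_zero (γ : ℂ) {L : ℕ} (μ : Fin L → ℂ) (y : Fin (L + 1) → ℂ)
    (hy : ∀ k l, k ≠ l → Complex.sinh (y k - y l) ≠ 0) : sigma6NullVector γ μ y ≠ 0 := by
  intro h
  have hzero (l : Fin (L + 1)) : ∃ k, av γ (y l - μ k) = 0 := by
    rcases div_eq_zero_iff.mp (congrFun h l) with hnum | hden
    · simpa [Finset.prod_eq_zero_iff] using hnum
    · obtain ⟨k, hk, hk0⟩ := Finset.prod_eq_zero_iff.mp hden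
      exact absurd hk0 (hy l k (Finset.ne_of_mem_erase hk).symm)
  choose f hf using hzero
  obtain ⟨k, l, hkl, hfkl⟩ := Fintype.exists_ne_map_eq_of_card_lt f (by simp)
  have hk := hf k
  have hl := hf l
  rw [hfkl] at hk
  rw [av] at hk hl
  apply hy k l hkl
  rw [show y k - y l = (y k - μ (f l) + γ) - (y l - μ (f l) + γ) by ring, Complex.sinh_sub, hk, hl]
  ring

/-- Vanishing of the reduced type-A coefficient determinant:
`det((σ_i^{(l)})_{0≤i,l≤L}) = 0`. -/
theorem reduced_typeA_det_vanishes (γ : ℂ) (L : ℕ) (hL : 1 ≤ L) (μ : Fin L → ℂ)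
    (x₀ : ℂ) (x : Fin L → ℂ)
    (hs : ∀ k l : Fin (L + 1), k ≠ l →
      Complex.sinh (consv x₀ x k - consv x₀ x l) ≠ 0) :
    Matrix.det (Matrix.of fun i l : Fin (L + 1) => sigma6 γ μ (consv x₀ x) l i) = 0 := by
  exact Matrix.exists_mulVec_eq_zero_iff.mp
    ⟨sigma6NullVector γ μ (consv x₀ x), sigma6NullVector_ne_zero γ μ _ hs,
      funext fun i => sum_sigma6_mul_nullVector γ μ _ hs i⟩
end

section
/- Trigonometric limit of the theta function: for every x ∈ ℂ, lim_{p → 0⁺} (−i)·p^{−1/4}·[x]_p = sinh(x), where the limit is taken over real p tending to 0 from above and [x]_p denotes the theta function with nome p. -/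
open scoped BigOperators Topology

open Complex in
/-- The coefficients of the theta series after its leading power of the nome is removed. -/
noncomputable def thetaCoeff (x : ℂ) (n : ℤ) : ℂ :=
  -I * (1/2) * exp (Real.pi * I * ((n : ℂ) - 1/2)) * exp (-(2*(n : ℂ)+1) * x)

/-- The exponent of the nome in the theta series, relative to its leading power. -/
def thetaExponent (n : ℤ) : ℕ := (n ^ 2 + n).toNat

theorem coe_thetaExponent (n : ℤ) : ((thetaExponent n : ℕ) : ℤ) = n ^ 2 + n :=
  Int.toNat_of_nonneg (by rcases le_or_gt 0 n with h | h <;> nlinarith)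

theorem thetaExponent_eq_zero_iff (n : ℤ) : thetaExponent n = 0 ↔ n = 0 ∨ n = -1 := by
  have h := coe_thetaExponent n
  constructor
  · intro h0
    rw [h0, Nat.cast_zero, show n ^ 2 + n = n * (n + 1) by ring, eq_comm, mul_eq_zero] at h
    omega
  · rintro (rfl | rfl) <;> rfl

open Complex in
/-- The theta function divided by the leading power of the nome is a power series in the nome. -/
theorem theta_rescaled_eq_tsum (x : ℂ) {p : ℝ} (hp : 0 < p) :
    -I * (p : ℂ) ^ (-(1/4 : ℂ)) * theta p x =
      ∑' n : ℤ, thetaCoeff x n * (p : ℂ) ^ thetaExponent n := by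
  rw [theta, ← mul_assoc, ← tsum_mul_left]
  refine tsum_congr fun n => ?_
  have hk : ((thetaExponent n : ℕ) : ℂ) = (n : ℂ) ^ 2 + n := by
    exact_mod_cast congrArg (Int.cast : ℤ → ℂ) (coe_thetaExponent n)
  have hpow : (p : ℂ) ^ thetaExponent n =
      (p : ℂ) ^ (-(1/4 : ℂ)) * (p : ℂ) ^ (((n : ℂ) + 1/2) ^ 2) := by
    rw [← cpow_add _ _ (by exact_mod_cast hp.ne'), ← cpow_natCast, hk]
    congr 1
    ring
  rw [hpow, thetaCoeff]
  ring

open Complex in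
theorem summable_norm_thetaCoeff_mul_pow (x : ℂ) {r : ℝ} (hr0 : 0 < r) (hr1 : r < 1) :
    Summable fun n : ℤ => ‖thetaCoeff x n‖ * r ^ thetaExponent n := by
  have hpi : (Real.pi : ℂ) ≠ 0 := by exact_mod_cast Real.pi_ne_zero
  set τ : ℂ := ((-Real.log r / Real.pi : ℝ) : ℂ) * I with hτ
  set z : ℂ := (Real.log r - 2 * x) / (2 * Real.pi * I) with hz
  have hs : Summable fun n : ℤ => jacobiTheta₂_term n z τ := by
    rw [summable_jacobiTheta₂_term_iff]
    simpa [hτ] using div_pos (neg_pos.2 (Real.log_neg hr0 hr1)) Real.pi_pos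
  refine (hs.norm.mul_left ((1/2) * ‖exp (-x)‖)).congr fun n => ?_
  have hunit : ‖exp (Real.pi * I * ((n : ℂ) - 1/2))‖ = 1 := by
    rw [show (Real.pi * I * ((n : ℂ) - 1/2)) = ((Real.pi * (n - 1/2) : ℝ) : ℂ) * I by
      push_cast; ring, norm_exp_ofReal_mul_I]
  have hpow : r ^ thetaExponent n = ‖exp (((n : ℂ) ^ 2 + n) * Real.log r)‖ := by
    have hk : ((thetaExponent n : ℕ) : ℂ) = (n : ℂ) ^ 2 + n := by
      exact_mod_cast congrArg (Int.cast : ℤ → ℂ) (coe_thetaExponent n)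
    rw [← hk, exp_nat_mul, ← ofReal_exp, Real.exp_log hr0, norm_pow, norm_real,
      Real.norm_of_nonneg hr0.le]
  have hexp : exp (-x) * jacobiTheta₂_term n z τ =
      exp (-(2*(n : ℂ)+1) * x) * exp (((n : ℂ) ^ 2 + n) * Real.log r) := by
    rw [jacobiTheta₂_term, ← exp_add, ← exp_add, hz, hτ]
    congr 1
    push_cast
    field_simp
    linear_combination (-(n : ℂ) ^ 2 * Real.log r) * I_sq
  rw [mul_assoc, ← norm_mul, hexp, norm_mul, hpow, thetaCoeff]
  simp only [norm_mul, hunit, norm_neg, norm_I, one_mul, mul_one]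
  norm_num
  ring

open Complex in
theorem tsum_thetaCoeff_mul_zero_pow (x : ℂ) :
    ∑' n : ℤ, thetaCoeff x n * (0 : ℂ) ^ thetaExponent n = sinh x := by
  rw [tsum_eq_sum (s := {0, -1}) fun n hn => ?_]
  · have h0 : exp (Real.pi * I * (((0 : ℤ) : ℂ) - 1/2)) = -I := by
      rw [show Real.pi * I * (((0 : ℤ) : ℂ) - 1/2) = -(Real.pi / 2 * I) by push_cast; ring,
        exp_neg, exp_pi_div_two_mul_I, inv_I]
    have h1 : exp (Real.pi * I * (((-1 : ℤ) : ℂ) - 1/2)) = I := by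
      rw [show Real.pi * I * (((-1 : ℤ) : ℂ) - 1/2) = Real.pi / 2 * I - 2 * Real.pi * I by
        push_cast; ring, exp_sub, exp_pi_div_two_mul_I, exp_two_pi_mul_I, div_one]
    rw [Finset.sum_pair (by decide), (thetaExponent_eq_zero_iff 0).2 (.inl rfl),
      (thetaExponent_eq_zero_iff (-1)).2 (.inr rfl), thetaCoeff, thetaCoeff, h0, h1, sinh,
      show -(2 * ((0 : ℤ) : ℂ) + 1) * x = -x by push_cast; ring,
      show -(2 * ((-1 : ℤ) : ℂ) + 1) * x = x by push_cast; ring]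
    linear_combination (1/2 * (exp (-x) - exp x)) * I_sq
  · have hk : thetaExponent n ≠ 0 := by
      simpa [thetaExponent_eq_zero_iff] using hn
    rw [zero_pow hk, mul_zero]

/-- Trigonometric limit of the theta function: for every `x ∈ ℂ`,
`lim_{p→0⁺} (−i)·p^{−1/4}·[x]_p = sinh(x)`. -/
theorem theta_trigonometric_limit (x : ℂ) :
    Filter.Tendsto (fun p : ℝ => -Complex.I * (p : ℂ) ^ (-(1/4 : ℂ)) * theta p x)
      (nhdsWithin 0 (Set.Ioi 0)) (nhds (Complex.sinh x)) := by
  rw [← tsum_thetaCoeff_mul_zero_pow]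
  refine Filter.Tendsto.congr' (f₁ := fun p : ℝ =>
    ∑' n : ℤ, thetaCoeff x n * (p : ℂ) ^ thetaExponent n) ?_ ?_
  · filter_upwards [self_mem_nhdsWithin] with p hp
    exact (theta_rescaled_eq_tsum x hp).symm
  · refine tendsto_tsum_of_dominated_convergence
      (summable_norm_thetaCoeff_mul_pow x (r := 1/2) (by norm_num) (by norm_num)) ?_ ?_
    · intro n
      have hc : Continuous fun p : ℝ => thetaCoeff x n * (p : ℂ) ^ thetaExponent n := by fun_prop
      simpa using (hc.tendsto 0).mono_left nhdsWithin_le_nhds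
    · filter_upwards [Ioo_mem_nhdsGT (show (0 : ℝ) < 1/2 by norm_num)] with p hp n
      rw [norm_mul, norm_pow, Complex.norm_real, Real.norm_of_nonneg hp.1.le]
      have := hp.1.le
      have := hp.2.le
      gcongr
end
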